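/- arXiv:2502.03756 — 5 statements merged into one kernel-verified Lean document; each statement's English description precedes it below -/
import Mathlib

section
/- Clarke's multiplier rule (simplified form): Let E be a real Banach space, U ⊆ E an open set, and f : U → ℝ a function that is Lipschitz on a neighborhood of every point of U. Suppose C ⊆ U is a closed convex set, x ∈ C, and f(x) = min_{x̃ ∈ C} f(x̃). Then there exists ξ ∈ ∂∘f(x) such that ξ(x̃ − x) ≥ 0 for every x̃ ∈ C. -/
open Filter Topology

/-- The Clarke (generalized) directional derivative of `f` at `y` in direction `w`:
`f°(y, w) = limsup_{ỹ → y, τ → 0+} (f(ỹ + τ w) − f(ỹ))/τ`. -/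
noncomputable def clarkeDeriv {E : Type*} [NormedAddCommGroup E] [NormedSpace ℝ E]
    (f : E → ℝ) (y w : E) : ℝ :=
  Filter.limsup (fun p : E × ℝ => (f (p.1 + p.2 • w) - f p.1) / p.2)
    ((𝓝 y) ×ˢ (𝓝[>] (0 : ℝ)))

/-- The Clarke subdifferential of `f` at `y`:
`∂∘f(y) = {ξ ∈ E* : ξ(w) ≤ f°(y, w) for all w}`. -/
def clarkeSubdiff {E : Type*} [NormedAddCommGroup E] [NormedSpace ℝ E]
    (f : E → ℝ) (y : E) : Set (E →L[ℝ] ℝ) :=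
  {ξ | ∀ w : E, ξ w ≤ clarkeDeriv f y w}

section ClarkeDerivative

variable {E : Type*} [NormedAddCommGroup E] [NormedSpace ℝ E] {f : E → ℝ} {x : E}
  {K : NNReal} {s : Set E}

theorem tendsto_add_smul_nhds_prod_nhdsGT (x w : E) :
    Tendsto (fun p : E × ℝ => p.1 + p.2 • w) (𝓝 x ×ˢ 𝓝[>] (0 : ℝ)) (𝓝 x) := by
  have h : Tendsto (fun p : E × ℝ => p.1 + p.2 • w) (𝓝 (x, (0 : ℝ))) (𝓝 x) := by
    have hc : Continuous (fun p : E × ℝ => p.1 + p.2 • w) := by fun_prop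
    simpa using hc.tendsto (x, (0 : ℝ))
  refine h.mono_left ?_
  rw [nhds_prod_eq]
  exact Filter.prod_mono le_rfl nhdsWithin_le_nhds

theorem eventually_pos_nhds_prod_nhdsGT {X : Type*} [TopologicalSpace X] (x : X) :
    ∀ᶠ p : X × ℝ in 𝓝 x ×ˢ 𝓝[>] (0 : ℝ), 0 < p.2 :=
  tendsto_snd.eventually self_mem_nhdsWithin

namespace LipschitzOnWith

theorem eventually_abs_slope_le (hf : LipschitzOnWith K f s) (hs : s ∈ 𝓝 x) (w : E) :
    ∀ᶠ p : E × ℝ in 𝓝 x ×ˢ 𝓝[>] (0 : ℝ),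
      |(f (p.1 + p.2 • w) - f p.1) / p.2| ≤ K * ‖w‖ := by
  filter_upwards [(tendsto_add_smul_nhds_prod_nhdsGT x w).eventually hs,
    tendsto_fst.eventually hs, eventually_pos_nhds_prod_nhdsGT x] with p h₁ h₂ h₃
  have h := hf.dist_le_mul _ h₁ _ h₂
  rw [Real.dist_eq, dist_eq_norm, add_sub_cancel_left, norm_smul, Real.norm_of_nonneg h₃.le] at h
  rw [abs_div, abs_of_pos h₃, div_le_iff₀ h₃]
  linarith

theorem isBoundedUnder_le_slope (hf : LipschitzOnWith K f s) (hs : s ∈ 𝓝 x) (w : E) :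
    IsBoundedUnder (· ≤ ·) (𝓝 x ×ˢ 𝓝[>] (0 : ℝ))
      (fun p : E × ℝ => (f (p.1 + p.2 • w) - f p.1) / p.2) :=
  ⟨K * ‖w‖, Filter.eventually_map.2
    ((hf.eventually_abs_slope_le hs w).mono fun _ h => (abs_le.1 h).2)⟩

theorem eventually_slope_lt (hf : LipschitzOnWith K f s) (hs : s ∈ 𝓝 x) {w : E} {b : ℝ}
    (hb : clarkeDeriv f x w < b) :
    ∀ᶠ p : E × ℝ in 𝓝 x ×ˢ 𝓝[>] (0 : ℝ), (f (p.1 + p.2 • w) - f p.1) / p.2 < b :=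
  eventually_lt_of_limsup_lt hb (hf.isBoundedUnder_le_slope hs w)

theorem clarkeDeriv_le (hf : LipschitzOnWith K f s) (hs : s ∈ 𝓝 x) {w : E} {b : ℝ}
    (hb : ∀ᶠ p : E × ℝ in 𝓝 x ×ˢ 𝓝[>] (0 : ℝ), (f (p.1 + p.2 • w) - f p.1) / p.2 ≤ b) :
    clarkeDeriv f x w ≤ b := by
  have hbdd : IsBoundedUnder (· ≥ ·) (𝓝 x ×ˢ 𝓝[>] (0 : ℝ))
      (fun p : E × ℝ => (f (p.1 + p.2 • w) - f p.1) / p.2) :=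
    ⟨-(K * ‖w‖), Filter.eventually_map.2
      ((hf.eventually_abs_slope_le hs w).mono fun _ h => (abs_le.1 h).1)⟩
  exact limsup_le_of_le hbdd.isCoboundedUnder_le hb

theorem clarkeDeriv_le_mul_norm (hf : LipschitzOnWith K f s) (hs : s ∈ 𝓝 x) (w : E) :
    clarkeDeriv f x w ≤ K * ‖w‖ :=
  hf.clarkeDeriv_le hs ((hf.eventually_abs_slope_le hs w).mono fun _ h => (abs_le.1 h).2)

theorem clarkeDeriv_add_le (hf : LipschitzOnWith K f s) (hs : s ∈ 𝓝 x) (v w : E) :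
    clarkeDeriv f x (v + w) ≤ clarkeDeriv f x v + clarkeDeriv f x w := by
  refine le_of_forall_pos_le_add fun ε hε => hf.clarkeDeriv_le hs ?_
  have hv := hf.eventually_slope_lt hs (show clarkeDeriv f x v < clarkeDeriv f x v + ε / 2 by
    linarith)
  have hw := hf.eventually_slope_lt hs (show clarkeDeriv f x w < clarkeDeriv f x w + ε / 2 by
    linarith)
  have ht := (tendsto_add_smul_nhds_prod_nhdsGT x w).prodMk
    (tendsto_snd : Tendsto Prod.snd (𝓝 x ×ˢ 𝓝[>] (0 : ℝ)) _)
  filter_upwards [ht.eventually hv, hw] with p h₁ h₂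
  have he : p.1 + p.2 • (v + w) = p.1 + p.2 • w + p.2 • v := by rw [smul_add]; abel
  rw [sub_div] at h₁ h₂ ⊢
  rw [he]
  linarith

theorem clarkeDeriv_smul_le (hf : LipschitzOnWith K f s) (hs : s ∈ 𝓝 x) {c : ℝ} (hc : 0 ≤ c)
    (w : E) : clarkeDeriv f x (c • w) ≤ c * clarkeDeriv f x w := by
  obtain rfl | hc := hc.eq_or_lt
  · simpa using hf.clarkeDeriv_le_mul_norm hs 0
  refine le_of_forall_pos_le_add fun ε hε => hf.clarkeDeriv_le hs ?_
  have hw := hf.eventually_slope_lt hs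
    (show clarkeDeriv f x w < clarkeDeriv f x w + ε / c by linarith [div_pos hε hc])
  have hmul : Tendsto (fun t : ℝ => t * c) (𝓝[>] 0) (𝓝[>] 0) := by
    refine tendsto_nhdsWithin_iff.2 ⟨?_, ?_⟩
    · have h : Tendsto (fun t : ℝ => t * c) (𝓝 0) (𝓝 (0 * c)) := tendsto_id.mul_const c
      rw [zero_mul] at h
      exact h.mono_left nhdsWithin_le_nhds
    · filter_upwards [self_mem_nhdsWithin] with t ht
      exact mul_pos ht hc
  have ht := (tendsto_fst : Tendsto Prod.fst (𝓝 x ×ˢ 𝓝[>] (0 : ℝ)) _).prodMk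
    (hmul.comp (tendsto_snd : Tendsto Prod.snd (𝓝 x ×ˢ 𝓝[>] (0 : ℝ)) _))
  filter_upwards [ht.eventually hw, eventually_pos_nhds_prod_nhdsGT x] with p h₁ h₂
  simp only [Function.comp_apply] at h₁
  rw [div_lt_iff₀ (mul_pos h₂ hc)] at h₁
  rw [smul_smul, div_le_iff₀ h₂]
  have he : (clarkeDeriv f x w + ε / c) * (p.2 * c) = (c * clarkeDeriv f x w + ε) * p.2 := by
    field_simp
  linarith

theorem continuous_clarkeDeriv (hf : LipschitzOnWith K f s) (hs : s ∈ 𝓝 x) :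
    Continuous (clarkeDeriv f x) := by
  refine (LipschitzWith.of_le_add_mul K fun v w => ?_).continuous
  have h₁ := hf.clarkeDeriv_add_le hs w (v - w)
  have h₂ := hf.clarkeDeriv_le_mul_norm hs (v - w)
  rw [add_sub_cancel] at h₁
  rw [dist_eq_norm]
  linarith

theorem convexOn_clarkeDeriv (hf : LipschitzOnWith K f s) (hs : s ∈ 𝓝 x) :
    ConvexOn ℝ Set.univ (clarkeDeriv f x) :=
  ⟨convex_univ, fun v _ w _ _ _ ha hb _ => (hf.clarkeDeriv_add_le hs _ _).trans
    (add_le_add (hf.clarkeDeriv_smul_le hs ha v) (hf.clarkeDeriv_smul_le hs hb w))⟩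

theorem clarkeDeriv_sub_nonneg_of_isMinOn (hf : LipschitzOnWith K f s) (hs : s ∈ 𝓝 x)
    {C : Set E} (hC : Convex ℝ C) (hx : x ∈ C) (hmin : IsMinOn f C x) {y : E} (hy : y ∈ C) :
    0 ≤ clarkeDeriv f x (y - x) := by
  have ht : Tendsto (fun t : ℝ => (x, t)) (𝓝[>] 0) (𝓝 x ×ˢ 𝓝[>] (0 : ℝ)) :=
    tendsto_const_nhds.prodMk tendsto_id
  have hpos : ∀ᶠ t : ℝ in 𝓝[>] 0, 0 ≤ (f (x + t • (y - x)) - f x) / t := by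
    filter_upwards [Ioc_mem_nhdsGT (zero_lt_one' ℝ)] with t ht
    exact div_nonneg (sub_nonneg.2 (hmin (hC.add_smul_sub_mem hx hy ⟨ht.1.le, ht.2⟩))) ht.1.le
  exact le_limsup_of_frequently_le (ht.frequently hpos.frequently)
    (hf.isBoundedUnder_le_slope hs _)

end LipschitzOnWith

end ClarkeDerivative

/-- A continuous convex function vanishing at `0` that is nonnegative on a convex set containing
`0` dominates a continuous linear functional that is nonnegative on that set. -/
theorem ConvexOn.exists_continuousLinearMap_le_of_nonneg {E : Type*} [NormedAddCommGroup E]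
    [NormedSpace ℝ E] {N : E → ℝ} (hN : ConvexOn ℝ Set.univ N) (hcont : Continuous N)
    (hN₀ : N 0 ≤ 0) {D : Set E} (hD : Convex ℝ D) (hD₀ : 0 ∈ D) (hnonneg : ∀ v ∈ D, 0 ≤ N v) :
    ∃ ξ : E →L[ℝ] ℝ, (∀ v, ξ v ≤ N v) ∧ ∀ v ∈ D, 0 ≤ ξ v := by
  have hconv : Convex ℝ {p : E × ℝ | N p.1 < p.2} := by
    simpa using hN.convex_strict_epigraph
  have hopen : IsOpen {p : E × ℝ | N p.1 < p.2} :=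
    isOpen_lt (hcont.comp continuous_fst) continuous_snd
  have hdisj : Disjoint {p : E × ℝ | N p.1 < p.2} (D ×ˢ {0}) := by
    rw [Set.disjoint_left]
    rintro ⟨v, r⟩ h ⟨hv, rfl⟩
    exact (hnonneg v hv).not_gt h
  obtain ⟨φ, u, hlt, hle⟩ :=
    geometric_hahn_banach_open hconv hopen (hD.prod (convex_singleton 0)) hdisj
  have hφ : ∀ v r, φ (v, r) = φ (v, 0) + r * φ (0, 1) := fun v r => by
    rw [← smul_eq_mul, ← map_smul, ← map_add]
    simp
  have hφ₀ : φ (0, 0) = 0 := map_zero φ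
  have hu : u ≤ 0 := by simpa [hφ₀] using hle (0, 0) ⟨hD₀, rfl⟩
  have hlt' : ∀ v, ∀ r > N v, φ (v, 0) + r * φ (0, 1) < u := fun v r hr => by
    rw [← hφ]
    exact hlt (v, r) hr
  set α := φ (0, 1)
  have hpos : ∀ ε > 0, ε * α < u := fun ε hε => by
    simpa [hφ₀] using hlt' 0 ε (hN₀.trans_lt hε)
  have hα : α < 0 := by linarith [hpos 1 one_pos]
  have hu₀ : 0 ≤ u := by
    by_contra! h
    have := hpos (u / (2 * α)) (div_pos_of_neg_of_neg h (by linarith))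
    have he : u / (2 * α) * α = u / 2 := by field_simp [hα.ne]
    linarith
  refine ⟨(-α)⁻¹ • φ.comp (ContinuousLinearMap.inl ℝ E ℝ), fun v => ?_, fun v hv => ?_⟩
  · refine le_of_forall_gt_imp_ge_of_dense fun r hr => ?_
    have := hlt' v r hr
    change (-α)⁻¹ * φ (v, 0) ≤ r
    rw [inv_mul_le_iff₀ (by linarith)]
    linarith
  · exact mul_nonneg (inv_nonneg.2 (by linarith)) (hu₀.trans (hle (v, 0) ⟨hv, rfl⟩))

/-- Clarke's multiplier rule (simplified form): if `f` is locally Lipschitz on an open set `U`,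
`C ⊆ U` is closed and convex, `x ∈ C`, and `f` attains its minimum over `C` at `x`, then
there exists `ξ ∈ ∂∘f(x)` with `ξ(x̃ − x) ≥ 0` for all `x̃ ∈ C`. -/
theorem clarke_multiplier_rule
    {E : Type*} [NormedAddCommGroup E] [NormedSpace ℝ E]
    (U : Set E) (hU : IsOpen U) (f : E → ℝ)
    (hf : ∀ y ∈ U, ∃ (K : NNReal) (s : Set E), s ∈ 𝓝 y ∧ LipschitzOnWith K f s)
    (C : Set E) (hCU : C ⊆ U) (hCclosed : IsClosed C) (hCconv : Convex ℝ C)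
    (x : E) (hx : x ∈ C) (hmin : ∀ y ∈ C, f x ≤ f y) :
    ∃ ξ ∈ clarkeSubdiff f x, ∀ y ∈ C, 0 ≤ ξ (y - x) := by
  obtain ⟨K, s, hs, hK⟩ := hf x (hCU hx)
  have hD : Convex ℝ ((fun v => x + v) ⁻¹' C) := hCconv.translate_preimage_right x
  obtain ⟨ξ, hξ, hξD⟩ := (hK.convexOn_clarkeDeriv hs).exists_continuousLinearMap_le_of_nonneg
    (hK.continuous_clarkeDeriv hs) (by simpa using hK.clarkeDeriv_le_mul_norm hs 0) hD
    (by simpa using hx) fun v hv => by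
      simpa using hK.clarkeDeriv_sub_nonneg_of_isMinOn hs hCconv hx hmin hv
  exact ⟨ξ, hξ, fun y hy => hξD _ (by simpa using hy)⟩
end

section
/- Let n ≥ 1, let S = {q ∈ ℝⁿ : ‖q‖ = 1} be the unit sphere, and let H : [0,1] × S → ℝⁿ be continuous. Suppose H(0, q) = p₀ for all q ∈ S (a constant map), and that there is a constant c with 0 ≤ c < 1 such that ‖H(1, q) − q‖ ≤ c for every q ∈ S. Then every point y ∈ ℝⁿ with ‖y‖ < 1 − c lies in the image of H, i.e., there exist t ∈ [0,1] and q ∈ S with H(t, q) = y. -/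
open Metric Set

open MeasureTheory Polynomial in
/-- If an integral of polynomials of bounded degree, as a function of the evaluation point, is
constant on a nontrivial interval `[0, δ]`, then it is constant. -/
theorem setIntegral_eval_eq_of_forall_mem_Icc {α : Type*} [MeasurableSpace α] {μ : Measure α}
    {s : Set α} {P : α → ℝ[X]} {d : ℕ} (hP : ∀ x, (P x).natDegree ≤ d)
    (hint : ∀ t, IntegrableOn (fun x => (P x).eval t) s μ) {δ : ℝ} (hδ : 0 < δ) {I : ℝ}
    (hI : ∀ t ∈ Icc 0 δ, ∫ x in s, (P x).eval t ∂μ = I) (t : ℝ) :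
    ∫ x in s, (P x).eval t ∂μ = I := by
  set v : ℕ → ℝ := fun i => δ * (i / (d + 1)) with hv
  set S := Finset.range (d + 1) with hS
  have hvinj : Set.InjOn v S := by
    intro i _ j _ hij
    have hd : (d : ℝ) + 1 ≠ 0 := by positivity
    simp only [hv] at hij
    field_simp at hij
    exact_mod_cast hij
  have hvmem : ∀ i ∈ S, v i ∈ Icc 0 δ := by
    intro i hi
    have hi' : (i : ℝ) ≤ d + 1 := by exact_mod_cast (Finset.mem_range.1 hi).le
    refine ⟨by positivity, ?_⟩
    have : (i : ℝ) / (d + 1) ≤ 1 := div_le_one_of_le₀ hi' (by positivity)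
    simpa [hv] using mul_le_mul_of_nonneg_left this hδ.le
  have key : ∀ x, (P x).eval t = ∑ i ∈ S, (P x).eval (v i) * (Lagrange.basis S v i).eval t := by
    intro x
    have hdeg : (P x).degree < S.card := by
      rw [hS, Finset.card_range]
      exact degree_le_natDegree.trans_lt (by exact_mod_cast Nat.lt_succ_of_le (hP x))
    conv_lhs => rw [Lagrange.eq_interpolate hvinj hdeg]
    simp [Lagrange.interpolate_apply, eval_finsetSum]
  have hsum : ∑ i ∈ S, (Lagrange.basis S v i).eval t = 1 := by
    rw [← eval_finsetSum, Lagrange.sum_basis hvinj ⟨0, by simp [hS]⟩, eval_one]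
  simp_rw [key]
  rw [integral_finsetSum _ fun i _ => (hint (v i)).mul_const _]
  simp_rw [integral_mul_const]
  rw [Finset.sum_congr rfl fun i hi => by rw [hI _ (hvmem i hi)], ← Finset.mul_sum, hsum, mul_one]

open Polynomial in
theorem ContinuousLinearMap.exists_polynomial_eval_eq_det_one_add_smul {E : Type*}
    [NormedAddCommGroup E] [NormedSpace ℝ E] [FiniteDimensional ℝ E] (A : E →L[ℝ] E) :
    ∃ P : ℝ[X], P.natDegree ≤ Module.finrank ℝ E ∧ ∀ t : ℝ, P.eval t = (1 + t • A).det := by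
  let b := Module.finBasis ℝ E
  let M := LinearMap.toMatrix b b (A : E →ₗ[ℝ] E)
  refine ⟨((X : ℝ[X]) • M.map C + (1 : Matrix _ _ ℝ).map C).det, ?_, fun t => ?_⟩
  · simpa using natDegree_det_X_add_C_le M 1
  · rw [ContinuousLinearMap.det, ← LinearMap.det_toMatrix b, ← coe_evalRingHom, RingHom.map_det]
    congr 1
    ext i j
    have h1 : LinearMap.toMatrix b b ((1 + t • A : E →L[ℝ] E) : E →ₗ[ℝ] E) = 1 + t • M := by
      rw [← LinearMap.toMatrix_one b, ← map_smul, ← map_add]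
      rfl
    rw [h1]
    by_cases hij : i = j <;> simp [hij, add_comm, mul_comm t, M]

section Perturbation

variable {E : Type*} [NormedAddCommGroup E]

theorem bijective_id_add_of_lipschitzWith [NormedSpace ℝ E] [CompleteSpace E] {ψ : E → E}
    {K : NNReal} (hψ : LipschitzWith K ψ) (hK : K < 1) :
    Function.Bijective fun x => x + ψ x := by
  have happ : ApproximatesLinearOn (fun x => x + ψ x)
      ((ContinuousLinearEquiv.refl ℝ E : E ≃L[ℝ] E) : E →L[ℝ] E) univ K := by
    rw [ApproximatesLinearOn.approximatesLinearOn_iff_lipschitzOnWith]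
    have : ((fun x => x + ψ x) - ⇑((ContinuousLinearEquiv.refl ℝ E : E ≃L[ℝ] E) : E →L[ℝ] E))
        = ψ := by
      ext x; simp
    rw [this]
    exact hψ.lipschitzOnWith
  have hc : Subsingleton E ∨
      K < ‖((ContinuousLinearEquiv.refl ℝ E : E ≃L[ℝ] E).symm : E →L[ℝ] E)‖₊⁻¹ := by
    rcases subsingleton_or_nontrivial E with h | h
    · exact Or.inl h
    · right
      have : ‖((ContinuousLinearEquiv.refl ℝ E : E ≃L[ℝ] E).symm : E →L[ℝ] E)‖₊ = 1 := by
        simp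
      rw [this]
      simpa using hK
  exact ⟨injOn_univ.1 (happ.injOn hc), happ.surjective hc⟩

theorem image_id_add_eq_of_bijective {ψ : E → E} {s : Set E} (hs : ∀ x ∉ s, ψ x = 0)
    (hb : Function.Bijective fun x => x + ψ x) : (fun x => x + ψ x) '' s = s := by
  ext z
  constructor
  · rintro ⟨x, hx, rfl⟩
    by_contra hz
    have : x + ψ x = x := hb.1 (by simp [hs _ hz])
    exact hz (by simpa only [this] using hx)
  · intro hz
    obtain ⟨x, rfl⟩ := hb.2 z
    refine ⟨x, ?_, rfl⟩
    by_contra hx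
    exact hx (by simpa [hs _ hx] using hz)

end Perturbation

section Surjectivity

open MeasureTheory Filter Topology Polynomial

variable {E : Type*} [NormedAddCommGroup E] [InnerProductSpace ℝ E] [FiniteDimensional ℝ E]
  [MeasurableSpace E] [BorelSpace E]

theorem setIntegral_det_one_add_fderiv_mul_pow {φ : E → E} (hφ : ContDiff ℝ 1 φ) {L : ℝ}
    (hL : ∀ x ∉ closedBall (0 : E) L, φ x = 0) (y : E) (C : ℝ) (N : ℕ) :
    ∫ x in closedBall (0 : E) L, (1 + fderiv ℝ φ x).det * (C - ‖x + φ x - y‖ ^ 2) ^ N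
      = ∫ x in closedBall (0 : E) L, (C - ‖x - y‖ ^ 2) ^ N := by
  have hcs : HasCompactSupport φ := HasCompactSupport.intro (isCompact_closedBall 0 L) hL
  obtain ⟨K, hK⟩ := hφ.lipschitzWith_of_hasCompactSupport hcs one_ne_zero
  have hφ' : Continuous (fderiv ℝ φ) := hφ.continuous_fderiv one_ne_zero
  have hφc : Continuous φ := hφ.continuous
  choose Q hQd hQ using fun x =>
    (fderiv ℝ φ x).exists_polynomial_eval_eq_det_one_add_smul
  set P : E → ℝ[X] := fun x => Q x * (Polynomial.C (C - ‖x - y‖ ^ 2)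
    - Polynomial.C (2 * inner ℝ (x - y) (φ x)) * X - Polynomial.C (‖φ x‖ ^ 2) * X ^ 2) ^ N with hP
  have hPd : ∀ x, (P x).natDegree ≤ Module.finrank ℝ E + N * 2 := by
    intro x
    refine natDegree_mul_le.trans (add_le_add (hQd x) (natDegree_pow_le.trans ?_))
    gcongr
    compute_degree
  have hPe : ∀ x t, (P x).eval t
      = (1 + t • fderiv ℝ φ x).det * (C - ‖x + t • φ x - y‖ ^ 2) ^ N := by
    intro x t
    have : x + t • φ x - y = (x - y) + t • φ x := by abel
    rw [this, norm_add_sq_real, norm_smul, inner_smul_right, mul_pow, Real.norm_eq_abs, sq_abs]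
    simp only [hP, eval_mul, hQ, eval_pow, eval_sub, eval_C, eval_X]
    congr 2
    ring
  have hdet : Continuous fun A : E →L[ℝ] E => A.det := ContinuousLinearMap.continuous_det
  have hint : ∀ t, IntegrableOn (fun x => (P x).eval t) (closedBall (0 : E) L) := by
    intro t
    simp_rw [hPe]
    refine ContinuousOn.integrableOn_compact (isCompact_closedBall 0 L)
      (Continuous.continuousOn ?_)
    exact (hdet.comp (by fun_prop)).mul (by fun_prop)
  have hpos : ∀ᶠ A : E →L[ℝ] E in 𝓝 1, 0 < A.det :=
    hdet.continuousAt.eventually (lt_mem_nhds (by simp [ContinuousLinearMap.det]))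
  obtain ⟨ε, hε, hball⟩ := Metric.eventually_nhds_iff.1 hpos
  obtain ⟨δ, hδ, hδε, hδ1⟩ : ∃ δ : ℝ, 0 < δ ∧ δ * K < ε ∧ δ * K < 1 := by
    refine ⟨min ε 1 / (K + 1), by positivity, ?_, ?_⟩
    all_goals
      have hm : 0 < min ε 1 := by positivity
      have : min ε 1 / (K + 1) * (K : ℝ) < min ε 1 := by
        rw [div_mul_eq_mul_div, div_lt_iff₀ (by positivity)]
        nlinarith
    · exact this.trans_le (min_le_left _ _)
    · exact this.trans_le (min_le_right _ _)
  have hI : ∀ t ∈ Icc 0 δ, ∫ x in closedBall (0 : E) L, (P x).eval t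
      = ∫ x in closedBall (0 : E) L, (C - ‖x - y‖ ^ 2) ^ N := by
    intro t ht
    have hlip : LipschitzWith (‖t‖₊ * K) fun x => t • φ x := by
      exact (lipschitzWith_smul t).comp hK
    have htK : t * K ≤ δ * K := by gcongr; exact ht.2
    have hbij := bijective_id_add_of_lipschitzWith hlip (by
      rw [← NNReal.coe_lt_coe]
      simpa [abs_of_nonneg ht.1] using htK.trans_lt hδ1)
    have himg := image_id_add_eq_of_bijective (s := closedBall (0 : E) L)
      (fun x hx => by simp [hL x hx]) hbij
    have hder : ∀ x ∈ closedBall (0 : E) L, HasFDerivWithinAt (fun x => x + t • φ x)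
        (1 + t • fderiv ℝ φ x) (closedBall 0 L) x := fun x _ =>
      ((hasFDerivAt_id x).add
        (((hφ.differentiable one_ne_zero x).hasFDerivAt).const_smul t)).hasFDerivWithinAt
    have hcv := integral_image_eq_integral_abs_det_fderiv_smul volume
      measurableSet_closedBall hder hbij.1.injOn fun x => (C - ‖x - y‖ ^ 2) ^ N
    rw [himg] at hcv
    rw [hcv]
    refine integral_congr_ae (Eventually.of_forall fun x => ?_)
    have hd : 0 < (1 + t • fderiv ℝ φ x).det := by
      refine hball ?_
      rw [dist_eq_norm, add_sub_cancel_left, norm_smul, Real.norm_eq_abs, abs_of_nonneg ht.1]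
      exact ((mul_le_mul_of_nonneg_left (norm_fderiv_le_of_lipschitz ℝ hK) ht.1).trans
        htK).trans_lt hδε
    simp only [hPe, smul_eq_mul, abs_of_pos hd]
  simpa [hPe] using setIntegral_eval_eq_of_forall_mem_Icc hPd hint hδ hI 1

/-- A compactly supported `C¹` perturbation of the identity is surjective. -/
theorem surjective_id_add_of_contDiff {φ : E → E} (hφ : ContDiff ℝ 1 φ)
    (hcs : HasCompactSupport φ) : Function.Surjective fun x => x + φ x := by
  intro y
  by_contra! hy
  have hφc : Continuous φ := hφ.continuous
  obtain ⟨L₀, hL₀⟩ := hcs.isBounded.subset_closedBall 0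
  set L := max L₀ (‖y‖ + 1) with hLdef
  have hL : ∀ x ∉ closedBall (0 : E) L, φ x = 0 := fun x hx =>
    image_eq_zero_of_notMem_tsupport fun h =>
      hx (closedBall_subset_closedBall (le_max_left _ _) (hL₀ h))
  set B := closedBall (0 : E) L with hB
  have hBc : IsCompact B := isCompact_closedBall 0 L
  have hyB : y ∈ B := by
    rw [hB, mem_closedBall_zero_iff]
    exact (by linarith : ‖y‖ ≤ ‖y‖ + 1).trans (le_max_right _ _)
  obtain ⟨x₀, -, hx₀⟩ := hBc.exists_isMinOn ⟨y, hyB⟩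
    (f := fun x => ‖x + φ x - y‖) (by fun_prop)
  set ε := ‖x₀ + φ x₀ - y‖ with hε
  have hεpos : 0 < ε := norm_pos_iff.2 (sub_ne_zero.2 (hy x₀))
  have hεle : ∀ x ∈ B, ε ≤ ‖x + φ x - y‖ := fun x hx => hx₀ hx
  obtain ⟨C₁, hC₁⟩ := hBc.exists_bound_of_continuousOn (f := fun x => ‖x + φ x - y‖ ^ 2)
    (by fun_prop)
  obtain ⟨C₂, hC₂⟩ := hBc.exists_bound_of_continuousOn (f := fun x => ‖x - y‖ ^ 2) (by fun_prop)
  have hdetc : Continuous fun x => (1 + fderiv ℝ φ x).det :=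
    ContinuousLinearMap.continuous_det.comp
      (continuous_const.add (hφ.continuous_fderiv one_ne_zero))
  obtain ⟨M, hM⟩ := hBc.exists_bound_of_continuousOn hdetc.continuousOn
  simp only [norm_pow, norm_norm] at hC₁ hC₂
  set C := max C₁ C₂ with hC
  set r := min (ε / 2) 1 with hr
  have hrpos : 0 < r := by positivity
  have hrε : r ^ 2 < ε ^ 2 := by
    have : r ≤ ε / 2 := min_le_left _ _
    gcongr
    linarith
  have hCε : ε ^ 2 ≤ C := (hC₁ y hyB |>.trans (le_max_left _ _)).trans'
    (by gcongr; exact hεle y hyB)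
  set a := C - r ^ 2
  set b := C - ε ^ 2
  have hb0 : 0 ≤ b := sub_nonneg.2 hCε
  have hba : b < a := by simp only [a, b]; linarith
  have ha0 : 0 < a := hb0.trans_lt hba
  set m := volume.real (closedBall y r)
  have hm : 0 < m := ENNReal.toReal_pos (measure_closedBall_pos volume y hrpos).ne'
    measure_closedBall_lt_top.ne
  have hsub : closedBall y r ⊆ B := by
    refine closedBall_subset_closedBall' ?_
    rw [dist_zero_right]
    have := min_le_right (ε / 2) 1
    have := le_max_right L₀ (‖y‖ + 1)
    linarith
  have hM0 : 0 ≤ M := (norm_nonneg _).trans (hM y hyB)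
  have key : ∀ N : ℕ, m * a ^ N ≤ M * b ^ N * volume.real B := by
    intro N
    have hcont : Continuous fun x : E => (C - ‖x - y‖ ^ 2) ^ N := by fun_prop
    calc m * a ^ N = ∫ _ in closedBall y r, a ^ N := by simp [m]
      _ ≤ ∫ x in closedBall y r, (C - ‖x - y‖ ^ 2) ^ N := by
        refine setIntegral_mono_on (integrableOn_const measure_closedBall_lt_top.ne)
          (hcont.continuousOn.integrableOn_compact (isCompact_closedBall y r))
          measurableSet_closedBall fun x hx => ?_
        have : ‖x - y‖ ≤ r := by simpa [dist_eq_norm] using hx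
        gcongr
        simp only [a]
        gcongr
      _ ≤ ∫ x in B, (C - ‖x - y‖ ^ 2) ^ N := by
        refine setIntegral_mono_set (hcont.continuousOn.integrableOn_compact hBc) ?_
          (Eventually.of_forall hsub)
        refine (ae_restrict_iff' measurableSet_closedBall).2 (Eventually.of_forall fun x hx => ?_)
        exact pow_nonneg (sub_nonneg.2 ((hC₂ x hx).trans (le_max_right _ _))) N
      _ = ∫ x in B, (1 + fderiv ℝ φ x).det * (C - ‖x + φ x - y‖ ^ 2) ^ N :=
        (setIntegral_det_one_add_fderiv_mul_pow hφ hL y C N).symm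
      _ ≤ ‖∫ x in B, (1 + fderiv ℝ φ x).det * (C - ‖x + φ x - y‖ ^ 2) ^ N‖ := le_abs_self _
      _ ≤ M * b ^ N * volume.real B := by
        refine norm_setIntegral_le_of_norm_le_const hBc.measure_lt_top fun x hx => ?_
        have h0 : 0 ≤ C - ‖x + φ x - y‖ ^ 2 :=
          sub_nonneg.2 ((hC₁ x hx).trans (le_max_left _ _))
        rw [norm_mul, norm_pow, Real.norm_of_nonneg h0]
        have h1 := hεle x hx
        have h2 := hM x hx
        simp only [b]
        gcongr
  have hlim : Tendsto (fun N : ℕ => M * volume.real B * (b / a) ^ N) atTop (𝓝 0) := by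
    simpa using (tendsto_pow_atTop_nhds_zero_of_lt_one (div_nonneg hb0 ha0.le)
      ((div_lt_one ha0).2 hba)).const_mul (M * volume.real B)
  refine hm.not_ge (ge_of_tendsto' hlim fun N => ?_)
  rw [div_pow, mul_div_assoc', le_div_iff₀ (by positivity)]
  linarith [key N]

end Surjectivity

section BoundedPerturbation

variable {E : Type*} [NormedAddCommGroup E] [InnerProductSpace ℝ E] [FiniteDimensional ℝ E]

/-- A bounded continuous perturbation of the identity is surjective. -/
theorem surjective_id_add_of_bounded {φ : E → E} (hφ : Continuous φ) {R : ℝ}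
    (hR : ∀ x, ‖φ x‖ ≤ R) : Function.Surjective fun x => x + φ x := by
  intro y
  by_contra! hy
  have hR0 : 0 ≤ R := (norm_nonneg _).trans (hR 0)
  obtain ⟨x₀, -, hx₀⟩ := (isCompact_closedBall y (R + 1)).exists_isMinOn
    ⟨y, mem_closedBall_self (by linarith)⟩ (f := fun x => ‖x + φ x - y‖) (by fun_prop)
  set ε := ‖x₀ + φ x₀ - y‖
  have hε : 0 < ε := norm_pos_iff.2 (sub_ne_zero.2 (hy x₀))
  obtain ⟨g, hg, hgφ, -⟩ := hφ.exists_contDiff_approx 1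
    (continuous_const (y := min ε 1)) fun _ => by positivity
  let χ : ContDiffBump y := ⟨R + 1, R + 2, by linarith, by linarith⟩
  borelize E
  obtain ⟨x, hx⟩ := surjective_id_add_of_contDiff (φ := fun x => χ x • g x)
    (χ.contDiff.smul hg) χ.hasCompactSupport.smul_right y
  have hgx := hgφ x
  rw [dist_eq_norm, lt_min_iff] at hgx
  have hgR : ‖g x‖ ≤ R + 1 := by
    have := norm_add_le (φ x) (g x - φ x)
    rw [add_sub_cancel] at this
    linarith [hR x]
  have hmem : x ∈ closedBall y (R + 1) := by
    have : x - y = -(χ x • g x) := by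
      rw [sub_eq_iff_eq_add, ← sub_eq_neg_add, eq_sub_iff_add_eq]
      exact hx
    rw [mem_closedBall, dist_eq_norm, this, norm_neg, norm_smul, Real.norm_of_nonneg χ.nonneg]
    exact (mul_le_of_le_one_left (norm_nonneg _) χ.le_one).trans hgR
  have h1 : ε ≤ ‖x + φ x - y‖ := hx₀ hmem
  have h2 : x + g x = y := by simpa [χ.one_of_mem_closedBall hmem] using hx
  have h3 : x + φ x - y = -(g x - φ x) := by rw [← h2]; abel
  rw [h3, norm_neg] at h1
  linarith [hgx.1]

/-- Coordinate-free form of `homotopy_from_constant_covers_ball`. -/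
theorem exists_eq_of_homotopy_from_const [Nontrivial E] {H : ℝ → E → E}
    (hcont : ContinuousOn (fun p : ℝ × E => H p.1 p.2) (Icc (0 : ℝ) 1 ×ˢ sphere (0 : E) 1))
    {p₀ : E} (h0 : ∀ q ∈ sphere (0 : E) 1, H 0 q = p₀) {c : ℝ}
    (h1 : ∀ q ∈ sphere (0 : E) 1, ‖H 1 q - q‖ ≤ c) {y : E} (hy : ‖y‖ < 1 - c) :
    ∃ t ∈ Icc (0 : ℝ) 1, ∃ q ∈ sphere (0 : E) 1, H t q = y := by
  by_contra! hne
  have hp₀ : p₀ ≠ y := by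
    obtain ⟨q, hq⟩ : (sphere (0 : E) 1).Nonempty := NormedSpace.sphere_nonempty.2 zero_le_one
    rw [← h0 q hq]
    exact hne 0 (by simp) q hq
  let τ : E → ℝ := fun x => max 0 (min 1 (2 * ‖x‖ - 1))
  have hτc : Continuous τ := by fun_prop
  have hτ : ∀ x, τ x ∈ Icc (0 : ℝ) 1 := fun x =>
    ⟨le_max_left _ _, max_le zero_le_one (min_le_left _ _)⟩
  have hsph : ∀ x : E, x ≠ 0 → ‖x‖⁻¹ • x ∈ sphere (0 : E) 1 := fun x hx => by
    rw [mem_sphere_zero_iff_norm, norm_smul, norm_inv, norm_norm,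
      inv_mul_cancel₀ (norm_ne_zero_iff.2 hx)]
  have hHcone : ∀ x : E, x ≠ 0 → ‖x‖ < 1 / 2 → H (τ x) (‖x‖⁻¹ • x) = p₀ := fun x hx hx' => by
    have : τ x = 0 := max_eq_left ((min_le_right _ _).trans (by linarith))
    rw [this, h0 _ (hsph x hx)]
  classical
  let F : E → E := fun x => if x = 0 then p₀ else H (τ x) (‖x‖⁻¹ • x)
  have hFc : Continuous F := by
    rw [continuous_iff_continuousAt]
    intro x
    rcases eq_or_ne x 0 with rfl | hx
    · have : (fun _ => p₀) =ᶠ[nhds (0 : E)] F := by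
        filter_upwards [ball_mem_nhds (0 : E) (by norm_num : (0 : ℝ) < 1 / 2)] with z hz
        by_cases hz0 : z = 0
        · simp [F, hz0]
        · simp only [F, if_neg hz0]
          exact (hHcone z hz0 (by simpa using hz)).symm
      exact continuousAt_const.congr this
    · have hon : ContinuousOn (fun z : E => H (τ z) (‖z‖⁻¹ • z)) {0}ᶜ := by
        refine hcont.comp (f := fun z : E => (τ z, ‖z‖⁻¹ • z)) ?_
          fun z hz => ⟨hτ z, hsph z hz⟩
        refine hτc.continuousOn.prodMk (ContinuousOn.fun_smul ?_ continuousOn_id)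
        exact continuous_norm.continuousOn.inv₀ fun z hz => norm_ne_zero_iff.2 hz
      have hnhds : ({0}ᶜ : Set E) ∈ nhds x := isOpen_compl_singleton.mem_nhds hx
      refine (hon.continuousAt hnhds).congr ?_
      filter_upwards [hnhds] with z hz
      exact (if_neg hz).symm
  have hFy : ∀ x, F x ≠ y := fun x => by
    by_cases hx : x = 0
    · simpa [F, hx] using hp₀
    · simpa [F, hx] using hne _ (hτ x) _ (hsph x hx)
  obtain ⟨R, hR⟩ :=
    (isCompact_Icc.prod (isCompact_sphere (0 : E) 1)).exists_bound_of_continuousOn hcont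
  have hFR : ∀ x, ‖F x‖ ≤ max ‖p₀‖ R := fun x => by
    by_cases hx : x = 0
    · simp [F, hx]
    · simp only [F, if_neg hx]
      exact (hR (τ x, ‖x‖⁻¹ • x) ⟨hτ x, hsph x hx⟩).trans (le_max_right _ _)
  let π : E → E := fun x => (max 1 ‖x‖)⁻¹ • x
  have hmax : ∀ x : E, 0 < max 1 ‖x‖ := fun x => zero_lt_one.trans_le (le_max_left _ _)
  have hπc : Continuous π :=
    ((continuous_const.max continuous_norm).inv₀ fun x => (hmax x).ne').smul continuous_id
  have hπ1 : ∀ x, ‖π x‖ ≤ 1 := fun x => by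
    rw [norm_smul, norm_inv, Real.norm_of_nonneg (hmax x).le, inv_mul_le_iff₀ (hmax x), mul_one]
    exact le_max_right _ _
  obtain ⟨x, hx⟩ := surjective_id_add_of_bounded (φ := fun x => F x - π x) (hFc.sub hπc)
    (fun x => (norm_sub_le _ _).trans (add_le_add (hFR x) (hπ1 x))) y
  rcases le_or_gt ‖x‖ 1 with hx1 | hx1
  · have : π x = x := by simp [π, max_eq_left hx1]
    simp only [this, add_sub_cancel] at hx
    exact hFy x hx
  · have hx0 : x ≠ 0 := by rintro rfl; simp at hx1; linarith
    have hτ1 : τ x = 1 := by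
      simp only [τ]
      rw [min_eq_left (by linarith), max_eq_right zero_le_one]
    have hπx : π x = ‖x‖⁻¹ • x := by simp [π, max_eq_right hx1.le]
    have hc := h1 _ (hsph x hx0)
    simp only [F, if_neg hx0, hτ1, hπx] at hx
    have hnorm := norm_sub_norm_le x (x - y)
    rw [sub_sub_cancel] at hnorm
    have : ‖x - y‖ ≤ c := by
      rwa [← hx, sub_add_cancel_left, norm_neg]
    linarith

end BoundedPerturbation

/-- A continuous homotopy `H : [0,1] × S^{n-1} → ℝⁿ` from a constant map to a map that is
uniformly `c`-close to the identity of the unit sphere (with `0 ≤ c < 1`) must cover every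
point of norm `< 1 − c`. -/
theorem homotopy_from_constant_covers_ball
    (n : ℕ) (hn : 1 ≤ n)
    (H : ℝ → EuclideanSpace ℝ (Fin n) → EuclideanSpace ℝ (Fin n))
    (hcont : ContinuousOn (fun p : ℝ × EuclideanSpace ℝ (Fin n) => H p.1 p.2)
      (Set.Icc (0 : ℝ) 1 ×ˢ sphere (0 : EuclideanSpace ℝ (Fin n)) 1))
    (p₀ : EuclideanSpace ℝ (Fin n))
    (h0 : ∀ q ∈ sphere (0 : EuclideanSpace ℝ (Fin n)) 1, H 0 q = p₀)
    (c : ℝ) (hc0 : 0 ≤ c) (hc1 : c < 1)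
    (h1 : ∀ q ∈ sphere (0 : EuclideanSpace ℝ (Fin n)) 1, ‖H 1 q - q‖ ≤ c)
    (y : EuclideanSpace ℝ (Fin n)) (hy : ‖y‖ < 1 - c) :
    ∃ t ∈ Set.Icc (0 : ℝ) 1, ∃ q ∈ sphere (0 : EuclideanSpace ℝ (Fin n)) 1, H t q = y := by
  have : Nonempty (Fin n) := ⟨⟨0, hn⟩⟩
  exact exists_eq_of_homotopy_from_const hcont h0 h1 hy
end

section
/- Let G be a group and let A be a group with exactly two elements. For every subgroup K of the direct product G × A, let H be the image of K under the first projection G × A → G. Then either K = H × A (that is, K = {(h, a) : h ∈ H, a ∈ A}), or there exists a group homomorphism π : H → A such that K = {(h, π(h)) : h ∈ H}. -/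
/-- A subgroup of `G × A` that meets `1 × A` trivially is the graph of a homomorphism defined on
its first projection. -/
theorem Subgroup.exists_monoidHom_graph_of_prod {G A : Type*} [Group G] [Group A]
    (K : Subgroup (G × A)) (hK : ∀ a : A, ((1 : G), a) ∈ K → a = 1) :
    ∃ π : K.map (MonoidHom.fst G A) →* A, ∀ p : G × A,
      p ∈ K ↔ ∃ hp : p.1 ∈ K.map (MonoidHom.fst G A), π ⟨p.1, hp⟩ = p.2 := by
  have unique : ∀ (g : G) (a b : A), (g, a) ∈ K → (g, b) ∈ K → a = b := by
    intro g a b ha hb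
    have h := K.mul_mem ha (K.inv_mem hb)
    simp only [Prod.inv_mk, Prod.mk_mul_mk, mul_inv_cancel] at h
    exact mul_inv_eq_one.mp (hK _ h)
  have total : ∀ h : K.map (MonoidHom.fst G A), ∃ a : A, ((h : G), a) ∈ K := by
    rintro ⟨_, ⟨g, a⟩, hg, rfl⟩
    exact ⟨a, hg⟩
  choose f hf using total
  refine ⟨MonoidHom.mk' f fun x y => unique _ _ _ (hf (x * y)) (K.mul_mem (hf x) (hf y)), ?_⟩
  rintro ⟨g, a⟩
  constructor
  · intro h
    exact ⟨⟨_, h, rfl⟩, unique g _ _ (hf ⟨g, _⟩) h⟩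
  · rintro ⟨hp, h : f ⟨g, hp⟩ = a⟩
    exact h ▸ hf ⟨g, hp⟩

/-- Classification of subgroups of `G × A` where `A` has exactly two elements: if `H` is the
image of a subgroup `K ≤ G × A` under the first projection, then either `K = H × A`, or
`K` is the graph of a homomorphism `π : H → A`. -/
theorem subgroup_of_prod_with_two_elements
    (G A : Type*) [Group G] [Group A] (hA : Nat.card A = 2)
    (K : Subgroup (G × A)) :
    let H : Subgroup G := K.map (MonoidHom.fst G A)
    K = H.prod ⊤ ∨
      ∃ π : H →* A, ∀ p : G × A, p ∈ K ↔ ∃ hp : p.1 ∈ H, π ⟨p.1, hp⟩ = p.2 := by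
  intro H
  by_cases hK : ∀ a : A, ((1 : G), a) ∈ K → a = 1
  · exact Or.inr (K.exists_monoidHom_graph_of_prod hK)
  · left
    push Not at hK
    obtain ⟨a, haK, ha⟩ := hK
    have vertical : ∀ b : A, ((1 : G), b) ∈ K := by
      intro b
      by_cases hb : b = 1
      · exact hb ▸ K.one_mem
      · exact ((Nat.card_eq_two_iff' (1 : A)).mp hA).unique ha hb ▸ haK
    ext ⟨g, b⟩
    constructor
    · intro h
      exact ⟨⟨_, h, rfl⟩, Subgroup.mem_top _⟩
    · rintro ⟨⟨⟨_, c⟩, hc, rfl⟩, -⟩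
      simpa using K.mul_mem hc (vertical (c⁻¹ * b))
end

section
/- Let n be a positive integer and let A and B be n × n complex matrices satisfying Aᵀ·A = 1 and Bᵀ·B = 1 (complex orthogonal matrices), where ᵀ denotes transpose. Set D = Aᴴ·A, where ᴴ denotes conjugate transpose. Then: (i) D is Hermitian (Dᴴ = D) and complex orthogonal (Dᵀ·D = 1); and (ii) Aᴴ·A = Bᴴ·B if and only if there exists an n × n matrix O with all entries real and Oᵀ·O = 1 such that B = O·A. In other words, A ↦ Aᴴ·A is injective on the right cosets of the real orthogonal group inside the complex orthogonal group. -/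
open Matrix

/-- A complex matrix has real entries iff its conjugate transpose is its transpose. -/
lemma Matrix.conjTranspose_eq_transpose_iff_im_eq_zero {m n : Type*} (M : Matrix m n ℂ) :
    Mᴴ = Mᵀ ↔ ∀ i j, (M i j).im = 0 := by
  constructor
  · intro h i j
    exact Complex.conj_eq_iff_im.mp (congrFun (congrFun h j) i)
  · intro h
    ext i j
    exact Complex.conj_eq_iff_im.mpr (h j i)

/-- The entrywise conjugate of a complex orthogonal matrix is complex orthogonal. -/
lemma Matrix.transpose_conjTranspose_mul_conjTranspose {n : Type*} [Fintype n] [DecidableEq n]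
    {A : Matrix n n ℂ} (hA : Aᵀ * A = 1) : Aᴴᵀ * Aᴴ = 1 := by
  have h : (A * Aᵀ)ᴴ = 1 := by rw [mul_eq_one_comm.mp hA, conjTranspose_one]
  rwa [conjTranspose_mul] at h

/-- For complex orthogonal `n × n` matrices `A`, `B` (i.e. `Aᵀ A = 1`):
(i) `D = Aᴴ A` is Hermitian and complex orthogonal; and
(ii) `Aᴴ A = Bᴴ B` iff `B = O · A` for some real orthogonal matrix `O`
(a complex orthogonal matrix with real entries). -/
theorem complex_orthogonal_coset_invariant
    (n : ℕ) (hn : 0 < n) (A B : Matrix (Fin n) (Fin n) ℂ)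
    (hA : Aᵀ * A = 1) (hB : Bᵀ * B = 1) :
    (Aᴴ * A)ᴴ = Aᴴ * A ∧ (Aᴴ * A)ᵀ * (Aᴴ * A) = 1 ∧
    (Aᴴ * A = Bᴴ * B ↔
      ∃ O : Matrix (Fin n) (Fin n) ℂ,
        (∀ i j, (O i j).im = 0) ∧ Oᵀ * O = 1 ∧ B = O * A) := by
  have hA' : A * Aᵀ = 1 := mul_eq_one_comm.mp hA
  have hAc : Aᴴᵀ * Aᴴ = 1 := transpose_conjTranspose_mul_conjTranspose hA
  refine ⟨by rw [conjTranspose_mul, conjTranspose_conjTranspose], ?_, ?_, ?_⟩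
  · calc (Aᴴ * A)ᵀ * (Aᴴ * A) = Aᵀ * (Aᴴᵀ * Aᴴ) * A := by
          rw [transpose_mul]; simp only [Matrix.mul_assoc]
      _ = 1 := by rw [hAc, Matrix.mul_one, hA]
  · intro h
    have hO : (B * Aᵀ)ᵀ * (B * Aᵀ) = 1 := by
      calc (B * Aᵀ)ᵀ * (B * Aᵀ) = A * (Bᵀ * B) * Aᵀ := by
            rw [transpose_mul, transpose_transpose]; simp only [Matrix.mul_assoc]
        _ = 1 := by rw [hB, Matrix.mul_one, hA']
    have hOc : (B * Aᵀ)ᴴ * (B * Aᵀ) = 1 := by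
      calc (B * Aᵀ)ᴴ * (B * Aᵀ) = Aᴴᵀ * (Bᴴ * B) * Aᵀ := by
            rw [conjTranspose_mul, show Aᵀᴴ = Aᴴᵀ from rfl]; simp only [Matrix.mul_assoc]
        _ = (Aᴴᵀ * Aᴴ) * (A * Aᵀ) := by rw [← h]; simp only [Matrix.mul_assoc]
        _ = 1 := by rw [hAc, hA', Matrix.mul_one]
    refine ⟨B * Aᵀ, ?_, hO, by rw [Matrix.mul_assoc, hA, Matrix.mul_one]⟩
    exact (conjTranspose_eq_transpose_iff_im_eq_zero _).mp
      (left_inv_eq_right_inv hOc (mul_eq_one_comm.mp hO))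
  · rintro ⟨O, hreal, hO, rfl⟩
    rw [← (conjTranspose_eq_transpose_iff_im_eq_zero O).mpr hreal] at hO
    rw [conjTranspose_mul, Matrix.mul_assoc, ← Matrix.mul_assoc Oᴴ, hO, Matrix.one_mul]
end

section
/- Let ε = e^{2πi/5}, s = ε − ε⁻¹, t = ε² − ε⁻². In the polynomial ring ℂ[X, Y], let W₁ be the ℂ-linear span of {X⁷ − 7X²Y⁵, Y⁷ + 7X⁵Y²} and W₂ the ℂ-linear span of {Y⁷ − 7Y²X⁵, X⁷ + 7Y⁵X²}. Let φ be the ℂ-algebra endomorphism of ℂ[X, Y] determined by φ(X) = −s·X + t·Y and φ(Y) = t·X + s·Y, and let ψ be the endomorphism determined by ψ(X) = ε⁻²·X, ψ(Y) = ε²·Y. Then ψ maps each of W₁ and W₂ into itself, and φ maps W₁ into W₁ or φ maps W₂ into W₂. -/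
open MvPolynomial

/-- The substitution `x ↦ -s x + t y`, `y ↦ t x + s y` preserves the plane of binary forms
spanned by `x⁷ - 7x²y⁵` and `y⁷ + 7x⁵y²` as soon as `s² = st + t²`. -/
theorem subst_septic_left {R : Type*} [CommRing R] (x y s t : R) (h : s ^ 2 = s * t + t ^ 2) :
    (-s * x + t * y) ^ 7 - 7 * (-s * x + t * y) ^ 2 * (t * x + s * y) ^ 5 =
      -(s ^ 2 + t ^ 2) ^ 3 *
        (t * (x ^ 7 - 7 * x ^ 2 * y ^ 5) + s * (y ^ 7 + 7 * x ^ 5 * y ^ 2)) := by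
  grind

theorem subst_septic_right {R : Type*} [CommRing R] (x y s t : R) (h : s ^ 2 = s * t + t ^ 2) :
    (t * x + s * y) ^ 7 + 7 * (-s * x + t * y) ^ 5 * (t * x + s * y) ^ 2 =
      -(s ^ 2 + t ^ 2) ^ 3 *
        (s * (x ^ 7 - 7 * x ^ 2 * y ^ 5) - t * (y ^ 7 + 7 * x ^ 5 * y ^ 2)) := by
  grind

theorem map_mem_span_pair {R A : Type*} [CommSemiring R] [Semiring A] [Algebra R A]
    (f : A →ₐ[R] A) {a b : A} (ha : f a ∈ Submodule.span R {a, b})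
    (hb : f b ∈ Submodule.span R {a, b}) :
    ∀ p ∈ Submodule.span R {a, b}, f p ∈ Submodule.span R {a, b} := by
  have h : Submodule.span R {a, b} ≤ (Submodule.span R {a, b}).comap f.toLinearMap := by
    rw [Submodule.span_le]
    rintro p (rfl | rfl)
    exacts [ha, hb]
  exact h

/-- In `ℂ[X, Y]` with `ε = e^{2πi/5}`, `s = ε − ε⁻¹`, `t = ε² − ε⁻²`, let
`W₁ = span{X⁷ − 7X²Y⁵, Y⁷ + 7X⁵Y²}` and `W₂ = span{Y⁷ − 7Y²X⁵, X⁷ + 7Y⁵X²}`.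
The endomorphism `ψ : X ↦ ε⁻²X, Y ↦ ε²Y` maps each of `W₁`, `W₂` into itself, and
`φ : X ↦ −sX + tY, Y ↦ tX + sY` maps `W₁` into `W₁` or `W₂` into `W₂`. -/
theorem icosahedral_invariant_plane
    (ε s t : ℂ) (hε : ε = Complex.exp (2 * Real.pi * Complex.I / 5))
    (hs : s = ε - ε⁻¹) (ht : t = ε ^ 2 - ε⁻¹ ^ 2)
    (W₁ W₂ : Submodule ℂ (MvPolynomial (Fin 2) ℂ))
    (hW₁ : W₁ = Submodule.span ℂ
      {(X 0) ^ 7 - 7 * (X 0) ^ 2 * (X 1) ^ 5, (X 1) ^ 7 + 7 * (X 0) ^ 5 * (X 1) ^ 2})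
    (hW₂ : W₂ = Submodule.span ℂ
      {(X 1) ^ 7 - 7 * (X 1) ^ 2 * (X 0) ^ 5, (X 0) ^ 7 + 7 * (X 1) ^ 5 * (X 0) ^ 2})
    (φ ψ : MvPolynomial (Fin 2) ℂ →ₐ[ℂ] MvPolynomial (Fin 2) ℂ)
    (hφ : φ = aeval ![C (-s) * X 0 + C t * X 1, C t * X 0 + C s * X 1])
    (hψ : ψ = aeval ![C (ε⁻¹ ^ 2) * X 0, C (ε ^ 2) * X 1]) :
    (∀ p ∈ W₁, ψ p ∈ W₁) ∧ (∀ p ∈ W₂, ψ p ∈ W₂) ∧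
    ((∀ p ∈ W₁, φ p ∈ W₁) ∨ (∀ p ∈ W₂, φ p ∈ W₂)) := by
  subst hW₁ hW₂ hφ hψ
  have h5 : ε ^ 5 = 1 := by
    rw [hε, ← Complex.exp_nat_mul, ← Complex.exp_two_pi_mul_I]
    congr 1
    push_cast
    ring
  have h1 : ε ≠ 1 := by
    have := (Complex.isPrimitiveRoot_exp 5 (by norm_num)).ne_one (by norm_num)
    rw [hε]
    exact_mod_cast this
  have hinv : ε⁻¹ = ε ^ 4 := inv_eq_of_mul_eq_one_right (by rw [← h5]; ring)
  have hcyc : ε ^ 4 + ε ^ 3 + ε ^ 2 + ε + 1 = 0 := by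
    have : (ε - 1) * (ε ^ 4 + ε ^ 3 + ε ^ 2 + ε + 1) = 0 := by linear_combination h5
    exact (mul_eq_zero.mp this).resolve_left (sub_ne_zero.mpr h1)
  have hst : s ^ 2 = s * t + t ^ 2 := by
    rw [hs, ht, hinv]
    grind
  have hC : (C s : MvPolynomial (Fin 2) ℂ) ^ 2 = C s * C t + C t ^ 2 := by
    simp only [← C_pow, ← C_mul, ← C_add, hst]
  have hCε : (C ε : MvPolynomial (Fin 2) ℂ) ^ 5 = 1 := by rw [← C_pow, h5, C_1]
  refine ⟨map_mem_span_pair _ ?_ ?_, map_mem_span_pair _ ?_ ?_,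
    .inl (map_mem_span_pair _ ?_ ?_)⟩ <;>
    rw [Submodule.mem_span_pair] <;>
    simp only [map_add, map_sub, map_mul, map_pow, map_ofNat, aeval_X,
      Matrix.cons_val_zero, Matrix.cons_val_one, smul_eq_C_mul, map_neg, hinv]
  · refine ⟨ε, 0, ?_⟩
    rw [C_0]
    grind
  · refine ⟨0, ε ^ 4, ?_⟩
    rw [C_0, C_pow]
    grind
  · refine ⟨ε ^ 4, 0, ?_⟩
    rw [C_0, C_pow]
    grind
  · refine ⟨0, ε, ?_⟩
    rw [C_0]
    grind
  · refine ⟨-(s ^ 2 + t ^ 2) ^ 3 * t, -(s ^ 2 + t ^ 2) ^ 3 * s, ?_⟩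
    rw [subst_septic_left _ _ _ _ hC]
    simp only [map_neg, map_mul, map_pow, map_add]
    ring
  · refine ⟨-(s ^ 2 + t ^ 2) ^ 3 * s, (s ^ 2 + t ^ 2) ^ 3 * t, ?_⟩
    rw [subst_septic_right _ _ _ _ hC]
    simp only [map_neg, map_mul, map_pow, map_add]
    ring
end
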